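/- For all n ≥ 8, there exists an n-column Order-Regular matrix with at least (35^(1/10))^(n-7) rows, i.e., Ω(1.4269^n) rows. -/

import Mathlib

/-- Successor row index, saturating at the last row (convention `A[m+1] = A[m]`). -/
def rowSucc {m : ℕ} (i : Fin m) : Fin m :=
  if h : i.1 + 1 < m then ⟨i.1 + 1, h⟩ else i

/-- The matrix `A` satisfies the Order-Regularity constraint for the pair of rows `(i, j)`:
there is a column `k` with `A[i,k] ≠ A[i+1,k] = A[j,k] = A[j+1,k]`. -/
def SatCon {m n : ℕ} (A : Fin m → Fin n → Bool) (i j : Fin m) : Prop :=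
  ∃ k : Fin n, A i k ≠ A (rowSucc i) k ∧ A (rowSucc i) k = A j k ∧ A j k = A (rowSucc j) k

/-- Order-Regularity: every pair of rows `i < j` satisfies the constraint, and the last two
rows are distinct. -/
def OrderRegular {m n : ℕ} (A : Fin m → Fin n → Bool) : Prop :=
  (∀ i j : Fin m, i < j → SatCon A i j) ∧
  ∀ _h : 2 ≤ m, A ⟨m - 2, by omega⟩ ≠ A ⟨m - 1, by omega⟩


/-- Order-Regularity of the first `m` rows and `n` columns of an infinite array. -/
def ORseq (m n : ℕ) (a : ℕ → ℕ → Bool) : Prop :=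
  ∀ i j, i < j → j < m → ∃ k, k < n ∧ a i k ≠ a (i + 1) k ∧ a (i + 1) k = a j k ∧
    (j + 1 < m → a j k = a (j + 1) k)

/-- Outer gadget, rows used at even positions of a block (as 6-bit numbers). -/
def gadP (I : ℕ) : ℕ :=
  [23, 41, 7, 42, 55, 59, 35, 1, 0].getD I 0

/-- Outer gadget, rows used at odd positions of a block. -/
def gadQ (I : ℕ) : ℕ :=
  [40, 19, 32, 27, 58, 47, 11, 2, 0].getD I 0

/-- Start row of the transition of type `t` in block `I`. -/
def trU (I : ℕ) (t : Fin 3) : ℕ := if t = 1 then gadQ I else gadP I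

/-- End row of the transition of type `t` in block `I`. -/
def trV (I : ℕ) (t : Fin 3) : ℕ :=
  if t = 0 then gadQ I else if t = 1 then gadP I else gadP (I + 1)

set_option maxRecDepth 100000 in
theorem gadget : ∀ J : Fin 9, ∀ I : Fin 9, I < J → ∀ t s : Fin 3, ∃ k : Fin 6,
    (trU I t).testBit k ≠ (trV I t).testBit k ∧ (trV I t).testBit k = (trU J s).testBit k ∧
    (trU J s).testBit k = (trV J s).testBit k := by
  decide

/-- Outer part of row `r` of the blowup. -/
def outerRow (m r : ℕ) : ℕ := if r % m % 2 = 0 then gadP (r / m) else gadQ (r / m)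

/-- The blowup of `a`. -/
def blow (m n : ℕ) (a : ℕ → ℕ → Bool) (r k : ℕ) : Bool :=
  if k < n then xor (a (r % m) k) (decide (r / m % 2 = 1) && xor (a 0 k) (a (m - 1) k))
  else (outerRow m r).testBit (k - n)

theorem step_cases (m r : ℕ) (hm : 0 < m) :
    (r % m + 1 < m ∧ (r + 1) / m = r / m ∧ (r + 1) % m = r % m + 1) ∨
    (r % m + 1 = m ∧ (r + 1) / m = r / m + 1 ∧ (r + 1) % m = 0) := by
  have h1 := Nat.mod_lt r hm
  have h2 := Nat.div_add_mod r m
  rcases Nat.lt_or_ge (r % m + 1) m with h | h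
  · left
    have := (Nat.div_mod_unique hm (a := r + 1) (c := r % m + 1) (d := r / m)).2
      ⟨by omega, h⟩
    exact ⟨h, this.1, this.2⟩
  · right
    have := (Nat.div_mod_unique hm (a := r + 1) (c := 0) (d := r / m + 1)).2
      ⟨by rw [Nat.mul_add]; omega, hm⟩
    exact ⟨by omega, this.1, this.2⟩

theorem outer_step (m r : ℕ) (hm : m % 2 = 1) :
    ∃ t : Fin 3, outerRow m r = trU (r / m) t ∧ outerRow m (r + 1) = trV (r / m) t := by
  unfold outerRow
  rcases step_cases m r (by omega) with ⟨h, h1, h2⟩ | ⟨h, h1, h2⟩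
  · rw [h1, h2]
    rcases Nat.mod_two_eq_zero_or_one (r % m) with e | e
    · exact ⟨0, by simp [trU, e], by
        have : (r % m + 1) % 2 ≠ 0 := by omega
        rw [if_neg this]; simp [trV]⟩
    · exact ⟨1, by simp [trU, e], by
        have : (r % m + 1) % 2 = 0 := by omega
        rw [if_pos this]; simp [trV]⟩
  · rw [h1, h2]
    have e : r % m % 2 = 0 := by omega
    exact ⟨2, by simp [trU, e], by simp [trV]⟩

theorem blow_or {m n : ℕ} {a : ℕ → ℕ → Bool} (hm : m % 2 = 1) (h : ORseq m n a) :
    ORseq (9 * m) (n + 6) (blow m n a) := by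
  intro r s hrs hs
  have hm0 : 0 < m := by omega
  have hJ : s / m < 9 := (Nat.div_lt_iff_lt_mul hm0).2 hs
  have hIJ : r / m ≤ s / m := Nat.div_le_div_right hrs.le
  rcases hIJ.lt_or_eq with hlt | heq
  · obtain ⟨t, ht1, ht2⟩ := outer_step m r hm
    obtain ⟨t', hs1, hs2⟩ := outer_step m s hm
    obtain ⟨k, hk1, hk2, hk3⟩ := gadget ⟨s / m, hJ⟩ ⟨r / m, by omega⟩ hlt t t'
    refine ⟨n + k, by omega, ?_⟩
    simp only [blow, show ¬ (n + (k : ℕ) < n) by omega, if_false, Nat.add_sub_cancel_left,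
      ht1, ht2, hs1, hs2]
    exact ⟨hk1, hk2, fun _ => hk3⟩
  · have e1 := Nat.div_add_mod r m
    have e2 := Nat.div_add_mod s m
    rw [heq] at e1
    have hlt : r % m < s % m := by omega
    have hsm := Nat.mod_lt s hm0
    obtain ⟨k, hk, h1, h2, h3⟩ := h _ _ hlt hsm
    refine ⟨k, by omega, ?_⟩
    have hr : (r + 1) / m = r / m ∧ (r + 1) % m = r % m + 1 := by
      rcases step_cases m r hm0 with ⟨_, h⟩ | ⟨h, _⟩
      · exact h
      · omega
    simp only [blow, hk, if_true, hr.1, hr.2, heq]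
    refine ⟨fun hh => h1 (by simpa using hh), by rw [h2], fun _ => ?_⟩
    rcases step_cases m s hm0 with ⟨hx, hy, hz⟩ | ⟨hx, hy, hz⟩
    · rw [hy, hz, h3 hx]
    · rw [hy, hz]
      have : s % m = m - 1 := by omega
      rw [this]
      rcases Nat.mod_two_eq_zero_or_one (s / m) with e | e
      · have : (s / m + 1) % 2 = 1 := by omega
        rw [e, this]
        cases a 0 k <;> cases a (m - 1) k <;> rfl
      · have : (s / m + 1) % 2 = 0 := by omega
        rw [e, this]
        cases a 0 k <;> cases a (m - 1) k <;> rfl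

theorem base_or (n : ℕ) (hn : 8 ≤ n) : ORseq 9 n (fun i k => decide (k < i)) := by
  intro i j hij hj
  refine ⟨i, by omega, ?_⟩
  have h1 : i < j + 1 := by omega
  simp [hij, h1]

theorem root_pow : ((35 : ℝ) ^ ((1 : ℝ) / 10)) ^ 6 ≤ 9 := by
  have h0 : (0 : ℝ) ≤ (35 : ℝ) ^ ((1 : ℝ) / 10) := by positivity
  have h : ((35 : ℝ) ^ ((1 : ℝ) / 10)) ^ 10 = 35 := by
    rw [← Real.rpow_natCast, ← Real.rpow_mul (by norm_num)]; norm_num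
  refine le_of_pow_le_pow_left₀ (n := 10) (by norm_num) (by norm_num) ?_
  rw [← pow_mul, show 6 * 10 = 10 * 6 from rfl, pow_mul, h]
  norm_num

theorem exists_seq (n : ℕ) (hn : 8 ≤ n) : ∃ (m : ℕ) (a : ℕ → ℕ → Bool),
    m % 2 = 1 ∧ ORseq m n a ∧ ((35 : ℝ) ^ ((1 : ℝ) / 10)) ^ (n - 7) ≤ (m : ℝ) := by
  induction n using Nat.strong_induction_on with
  | _ n ih =>
    rcases Nat.lt_or_ge n 14 with h | h
    · refine ⟨9, _, rfl, base_or n hn, ?_⟩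
      have h1 : (1 : ℝ) ≤ (35 : ℝ) ^ ((1 : ℝ) / 10) :=
        Real.one_le_rpow (by norm_num) (by norm_num)
      exact (pow_le_pow_right₀ h1 (by omega : n - 7 ≤ 6)).trans (by exact_mod_cast root_pow)
    · obtain ⟨m, a, h1, h2, h3⟩ := ih (n - 6) (by omega) (by omega)
      refine ⟨9 * m, blow m (n - 6) a, by omega, ?_, ?_⟩
      · have := blow_or h1 h2
        rwa [Nat.sub_add_cancel (by omega)] at this
      · rw [show n - 7 = 6 + (n - 6 - 7) by omega, pow_add]
        push_cast
        exact mul_le_mul root_pow h3 (by positivity) (by norm_num)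

theorem seq_to_matrix {m n : ℕ} {a : ℕ → ℕ → Bool} (h : ORseq m n a) :
    OrderRegular (fun (i : Fin m) (k : Fin n) => a i k) := by
  refine ⟨?_, ?_⟩
  · intro i j hij
    have hij' : i.1 < j.1 := hij
    obtain ⟨k, hk, h1, h2, h3⟩ := h i j hij' j.2
    have hi : ((rowSucc i : Fin m) : ℕ) = i.1 + 1 := by
      have : i.1 + 1 < m := by omega
      simp [rowSucc, this]
    refine ⟨⟨k, hk⟩, ?_⟩
    simp only [hi]
    refine ⟨h1, h2, ?_⟩
    by_cases hj : j.1 + 1 < m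
    · have : ((rowSucc j : Fin m) : ℕ) = j.1 + 1 := by simp [rowSucc, hj]
      rw [this]; exact h3 hj
    · have : rowSucc j = j := by simp [rowSucc, hj]
      rw [this]
  · intro hm heq
    obtain ⟨k, hk, h1, -, -⟩ := h (m - 2) (m - 1) (by omega) (by omega)
    rw [show m - 2 + 1 = m - 1 by omega] at h1
    exact h1 (congrFun heq ⟨k, hk⟩)

theorem stmt14 : ∀ n : ℕ, 8 ≤ n → ∃ (m : ℕ) (A : Fin m → Fin n → Bool),
    OrderRegular A ∧ ((35 : ℝ) ^ ((1 : ℝ) / 10)) ^ (n - 7) ≤ (m : ℝ) := by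
  intro n hn
  obtain ⟨m, a, -, h2, h3⟩ := exists_seq n hn
  exact ⟨m, _, seq_to_matrix h2, h3⟩
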